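/- If n > m and U is a non-empty open subset of ℝⁿ, then there is no injective continuous map from U into ℝᵐ. -/

import Mathlib

open Set Filter Topology MeasureTheory

/-- The determinant of `1 + A` is a fixed combination of the determinants of `1 + t • A`,
`t` in a finite set of more than `dim` nodes (Lagrange interpolation). -/
lemma det_interp {n : ℕ} (s : Finset ℝ) (hs : n < s.card)
    (A : EuclideanSpace ℝ (Fin n) →L[ℝ] EuclideanSpace ℝ (Fin n)) :
    (ContinuousLinearMap.id ℝ _ + A).det =
      ∑ t ∈ s, (ContinuousLinearMap.id ℝ _ + t • A).det * (Lagrange.basis s id t).eval 1 := by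
  classical
  let b := (EuclideanSpace.basisFun (Fin n) ℝ).toBasis
  let M := LinearMap.toMatrix b b (A : EuclideanSpace ℝ (Fin n) →ₗ[ℝ] EuclideanSpace ℝ (Fin n))
  let p : Polynomial ℝ := Matrix.det
    ((Polynomial.X : Polynomial ℝ) • M.map Polynomial.C + (1 : Matrix (Fin n) (Fin n) ℝ).map Polynomial.C)
  have hp : p.natDegree ≤ n := by
    have := Polynomial.natDegree_det_X_add_C_le M (1 : Matrix (Fin n) (Fin n) ℝ)
    rwa [Fintype.card_fin] at this
  have hpe : ∀ t : ℝ, p.eval t = (ContinuousLinearMap.id ℝ _ + t • A).det := by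
    intro t
    have h1 : p.eval t = (t • M + 1).det := by
      rw [← Polynomial.coe_evalRingHom, RingHom.map_det]
      congr 1
      ext i j
      by_cases hij : i = j <;> simp [hij] <;> ring
    rw [h1, ContinuousLinearMap.det, ← LinearMap.det_toMatrix b]
    congr 1
    simp [M, add_comm]
  have hdeg : p.degree < s.card := by
    refine lt_of_le_of_lt Polynomial.degree_le_natDegree ?_
    exact_mod_cast lt_of_le_of_lt hp hs
  have := congrArg (Polynomial.eval 1) (Lagrange.eq_interpolate (v := id) (s := s)
    (Function.injective_id.injOn) hdeg)
  have h1 := hpe 1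
  rw [one_smul] at h1
  rw [← h1, this]
  simp [Lagrange.interpolate_apply, Polynomial.eval_finsetSum, hpe]

lemma sum_interp {s : Finset ℝ} (hs : s.Nonempty) :
    ∑ t ∈ s, (Lagrange.basis s id t).eval 1 = (1 : ℝ) := by
  rw [← Polynomial.eval_finsetSum, Lagrange.sum_basis Function.injective_id.injOn hs]
  simp

/-- Surjectivity and injectivity of small Lipschitz perturbations of the identity. -/
lemma perturb_bij {n : ℕ} (G : EuclideanSpace ℝ (Fin n) → EuclideanSpace ℝ (Fin n))
    (C : NNReal) (hG : LipschitzWith C G) (t : ℝ) (ht : 0 ≤ t) (htC : t * C < 1) :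
    Function.Bijective (fun x => x + t • G x) := by
  have key : ApproximatesLinearOn (fun x => x + t • G x)
      ((ContinuousLinearEquiv.refl ℝ (EuclideanSpace ℝ (Fin n)) : _ ≃L[ℝ] _) :
        EuclideanSpace ℝ (Fin n) →L[ℝ] EuclideanSpace ℝ (Fin n)) univ (t.toNNReal * C) := by
    intro x _ y _
    have : x + t • G x - (y + t • G y) - (x - y) = t • (G x - G y) := by
      rw [smul_sub]; abel
    simp only [ContinuousLinearEquiv.coe_coe, ContinuousLinearEquiv.refl_apply, this]
    rw [norm_smul, Real.norm_of_nonneg ht]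
    have := hG.norm_sub_le x y
    push_cast
    rw [Real.coe_toNNReal _ ht, mul_assoc]
    gcongr
  have hc : Subsingleton (EuclideanSpace ℝ (Fin n)) ∨ t.toNNReal * C <
      ‖((ContinuousLinearEquiv.refl ℝ (EuclideanSpace ℝ (Fin n))).symm :
        EuclideanSpace ℝ (Fin n) →L[ℝ] EuclideanSpace ℝ (Fin n))‖₊⁻¹ := by
    rcases subsingleton_or_nontrivial (EuclideanSpace ℝ (Fin n)) with h | h
    · exact Or.inl h
    · right
      have : ‖((ContinuousLinearEquiv.refl ℝ (EuclideanSpace ℝ (Fin n))).symm :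
        EuclideanSpace ℝ (Fin n) →L[ℝ] EuclideanSpace ℝ (Fin n))‖₊ = 1 := by
        have := ContinuousLinearMap.norm_id (𝕜 := ℝ) (E := EuclideanSpace ℝ (Fin n))
        exact NNReal.eq this
      rw [this, inv_one, ← NNReal.coe_lt_coe]
      push_cast
      rwa [Real.coe_toNNReal _ ht]
  exact ⟨injOn_univ.1 (key.injOn hc), key.surjective hc⟩

/-- A unit-norm `C¹` map has singular derivative. -/
lemma det_zero_of_norm_one {n : ℕ} (r : EuclideanSpace ℝ (Fin n) → EuclideanSpace ℝ (Fin n))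
    (hr : ContDiff ℝ 1 r) (h1 : ∀ x, ‖r x‖ = 1) (x : EuclideanSpace ℝ (Fin n)) :
    (fderiv ℝ r x).det = 0 := by
  have hd : HasFDerivAt r (fderiv ℝ r x) x := (hr.differentiable (by simp) x).hasFDerivAt
  have h2 := hd.inner ℝ hd
  have h3 : (fun y => inner ℝ (r y) (r y)) = fun _ => (1 : ℝ) := by
    funext y; rw [real_inner_self_eq_norm_sq, h1]; norm_num
  rw [h3] at h2
  have h4 := h2.unique (hasFDerivAt_const (1 : ℝ) x)
  by_contra hne
  have hu : Function.Surjective (fderiv ℝ r x) := by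
    have := (LinearMap.equivOfDetNeZero _ hne).surjective
    exact this
  obtain ⟨v, hv⟩ := hu (r x)
  have h5 := congrArg (fun L => L v) h4
  simp [fderivInnerCLM_apply, hv, h1] at h5

/-- No `C¹` map of constant norm one is radial outside the unit ball. -/
lemma no_retraction {n : ℕ} (r : EuclideanSpace ℝ (Fin n) → EuclideanSpace ℝ (Fin n))
    (hr : ContDiff ℝ 1 r) (h1 : ∀ x, ‖r x‖ = 1)
    (hout : ∀ x, 1 ≤ ‖x‖ → r x = ‖x‖⁻¹ • x) : False := by
  let χ : ContDiffBump (0 : EuclideanSpace ℝ (Fin n)) := ⟨2, 3, by norm_num, by norm_num⟩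
  let G : EuclideanSpace ℝ (Fin n) → EuclideanSpace ℝ (Fin n) := fun x => χ x • (r x - x)
  have hGd : ContDiff ℝ 1 G := χ.contDiff.smul (hr.sub contDiff_id)
  have hGs : HasCompactSupport G := χ.hasCompactSupport.smul_right
  obtain ⟨C, hC⟩ := hGd.lipschitzWith_of_hasCompactSupport hGs (by simp)
  have hD : Continuous (fderiv ℝ G) := hGd.continuous_fderiv (by simp)
  have hin : ∀ x, ‖x‖ ≤ 1 → G x = r x - x := by
    intro x hx
    have : χ x = 1 := χ.one_of_mem_closedBall (by simp [χ]; linarith)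
    simp [G, this]
  have hDin : ∀ x, ‖x‖ ≤ 1 → ContinuousLinearMap.id ℝ _ + fderiv ℝ G x = fderiv ℝ r x := by
    intro x hx
    have hev : G =ᶠ[𝓝 x] fun y => r y - y := by
      have : Metric.ball (0 : EuclideanSpace ℝ (Fin n)) 2 ∈ 𝓝 x :=
        Metric.isOpen_ball.mem_nhds (by simp; linarith)
      filter_upwards [this] with y hy
      have : χ y = 1 := χ.one_of_mem_closedBall (Metric.ball_subset_closedBall hy)
      simp [G, this]
    rw [hev.fderiv_eq, fderiv_fun_sub (hr.differentiable (by simp) x) differentiableAt_fun_id]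
    simp
  let B : Set (EuclideanSpace ℝ (Fin n)) := Metric.closedBall 0 1
  have hBc : IsCompact B := isCompact_closedBall _ _
  have hcd : Continuous fun z : ℝ × EuclideanSpace ℝ (Fin n) =>
      (ContinuousLinearMap.id ℝ (EuclideanSpace ℝ (Fin n)) + z.1 • fderiv ℝ G z.2).det := by
    refine ContinuousLinearMap.continuous_det.comp ?_
    exact continuous_const.add (continuous_fst.smul (hD.comp continuous_snd))
  have hpos : ∀ᶠ t : ℝ in 𝓝 0, ∀ x ∈ B,
      0 < (ContinuousLinearMap.id ℝ (EuclideanSpace ℝ (Fin n)) + t • fderiv ℝ G x).det := by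
    refine hBc.eventually_forall_of_forall_eventually ?_
    intro x _
    refine hcd.continuousAt.eventually (lt_mem_nhds ?_)
    simp [ContinuousLinearMap.det]
  have hsm : ∀ᶠ t : ℝ in 𝓝 0, t * C < 1 := by
    have : Continuous fun t : ℝ => t * C := by fun_prop
    exact this.continuousAt.eventually (gt_mem_nhds (by simp))
  have hlt : ∀ᶠ t : ℝ in 𝓝 0, t < 1 := gt_mem_nhds (by norm_num)
  obtain ⟨δ, hδ, hall⟩ := Metric.eventually_nhds_iff.1 (hpos.and (hsm.and hlt))
  have hvol : ∀ t ∈ Ioo 0 δ, ∫ x in B,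
      (ContinuousLinearMap.id ℝ (EuclideanSpace ℝ (Fin n)) + t • fderiv ℝ G x).det
        = volume.real B := by
    intro t ht
    obtain ⟨hp, hs, hl⟩ := hall (y := t) (by rw [Real.dist_eq, sub_zero, abs_of_pos ht.1]; exact ht.2)
    have hbij := perturb_bij G C hC t ht.1.le hs
    have himg : (fun x => x + t • G x) '' B = B := by
      apply Subset.antisymm
      · rintro _ ⟨x, hx, rfl⟩
        have hx' : ‖x‖ ≤ 1 := by simpa [B] using hx
        have e : x + t • G x = (1 - t) • x + t • r x := by
          rw [hin x hx', smul_sub, sub_smul, one_smul]; abel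
        simp only [B, mem_closedBall_zero_iff, e]
        calc ‖(1 - t) • x + t • r x‖ ≤ ‖(1 - t) • x‖ + ‖t • r x‖ := norm_add_le _ _
          _ = (1 - t) * ‖x‖ + t * 1 := by
            rw [norm_smul, norm_smul, h1, Real.norm_of_nonneg ht.1.le,
              Real.norm_of_nonneg (by linarith)]
          _ ≤ 1 := by nlinarith [ht.1]
      · intro y hy
        obtain ⟨x, rfl⟩ := hbij.2 y
        refine ⟨x, ?_, rfl⟩
        by_contra hx
        have hx' : 1 < ‖x‖ := by simpa [B] using hx
        have hy' : ‖x + t • G x‖ ≤ 1 := by simpa [B] using hy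
        have e : x + t • G x = (1 + t * χ x * (‖x‖⁻¹ - 1)) • x := by
          simp only [G, hout x hx'.le]
          module
        have hχ0 : 0 ≤ χ x := χ.nonneg
        have hχ1 : χ x ≤ 1 := χ.le_one
        have ha0 : 0 ≤ t * χ x := mul_nonneg ht.1.le hχ0
        have ha1 : t * χ x < 1 := by nlinarith [ht.1]
        have hge : (1 + t * χ x * (‖x‖⁻¹ - 1)) * ‖x‖ = ‖x‖ - t * χ x * (‖x‖ - 1) := by
          field_simp
          ring
        rw [e, norm_smul] at hy'
        have := (le_abs_self (1 + t * χ x * (‖x‖⁻¹ - 1)))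
        have h3 := mul_le_mul_of_nonneg_right this (norm_nonneg x)
        rw [hge] at h3
        rw [Real.norm_eq_abs] at hy'
        nlinarith
    have hder : ∀ x ∈ B, HasFDerivWithinAt (fun x => x + t • G x)
        (ContinuousLinearMap.id ℝ (EuclideanSpace ℝ (Fin n)) + t • fderiv ℝ G x) B x := by
      intro x _
      exact ((hasFDerivAt_id x).add
        (((hGd.differentiable (by simp) x).hasFDerivAt).const_smul t)).hasFDerivWithinAt
    have hcv := integral_image_eq_integral_abs_det_fderiv_smul volume hBc.measurableSet hder
      hbij.1.injOn (fun _ => (1 : ℝ))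
    rw [himg] at hcv
    simp only [smul_eq_mul, mul_one] at hcv
    rw [setIntegral_const, smul_eq_mul, mul_one] at hcv
    rw [hcv]
    refine setIntegral_congr_fun hBc.measurableSet fun x hx => ?_
    exact (abs_of_pos (hp x hx)).symm
  obtain ⟨s, hsub, hcard⟩ := (Ioo_infinite hδ).exists_subset_card_eq (n + 1)
  have hint : ∫ x in B, (ContinuousLinearMap.id ℝ (EuclideanSpace ℝ (Fin n)) + fderiv ℝ G x).det
      = volume.real B := by
    simp_rw [det_interp s (by omega) (fderiv ℝ G _)]
    rw [integral_finsetSum]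
    · simp_rw [integral_mul_const]
      rw [Finset.sum_congr rfl fun t ht => by rw [hvol t (hsub ht)], ← Finset.mul_sum,
        sum_interp (Finset.card_pos.1 (by omega)), mul_one]
    · intro t _
      refine Integrable.mul_const ?_ _
      refine ContinuousOn.integrableOn_compact hBc ?_
      exact (hcd.comp (continuous_const.prodMk continuous_id)).continuousOn
  have hzero : ∫ x in B, (ContinuousLinearMap.id ℝ (EuclideanSpace ℝ (Fin n)) + fderiv ℝ G x).det
      = 0 := by
    rw [setIntegral_congr_fun hBc.measurableSet (g := fun _ => (0 : ℝ))]
    · simp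
    · intro x hx
      have hx' : ‖x‖ ≤ 1 := by simpa [B] using hx
      simp only [hDin x hx', det_zero_of_norm_one r hr h1 x]
  have hvp : 0 < volume.real B := by
    refine ENNReal.toReal_pos ?_ hBc.measure_lt_top.ne
    exact (Metric.measure_closedBall_pos volume _ one_pos).ne'
  linarith

/-- A continuous self-map of `ℝⁿ`, identity outside a ball, has a zero. -/
lemma exists_zero_of_eq_id {n : ℕ} (H : EuclideanSpace ℝ (Fin n) → EuclideanSpace ℝ (Fin n))
    (hH : Continuous H) (hid : ∀ x, 9 / 10 ≤ ‖x‖ → H x = x) (hne : ∀ x, H x ≠ 0) : False := by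
  have hS : IsClosed {x : EuclideanSpace ℝ (Fin n) | 1 ≤ ‖x‖} :=
    isClosed_le continuous_const continuous_norm
  have hU : {x : EuclideanSpace ℝ (Fin n) | 9 / 10 < ‖x‖} ∈
      𝓝ˢ {x : EuclideanSpace ℝ (Fin n) | 1 ≤ ‖x‖} := by
    refine (isOpen_lt continuous_const continuous_norm).mem_nhdsSet.2 fun x hx => ?_
    have : (1 : ℝ) ≤ ‖x‖ := hx
    show (9 / 10 : ℝ) < ‖x‖
    linarith
  obtain ⟨g, hg, hga, hge, -⟩ := hH.exists_contDiff_approx_and_eqOn 1 (ε := fun x => ‖H x‖)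
    hH.norm (fun x => norm_pos_iff.2 (hne x)) hS hU
    (contDiff_id.contDiffOn.congr fun x hx => hid x (le_of_lt hx))
  have hg0 : ∀ x, g x ≠ 0 := by
    intro x hx
    have := hga x
    rw [hx, dist_zero_left] at this
    exact lt_irrefl _ this
  have hg' : ContDiff ℝ 1 g := hg
  refine no_retraction (fun x => ‖g x‖⁻¹ • g x) ?_ ?_ ?_
  · exact ((hg'.norm ℝ hg0).inv fun x => norm_ne_zero_iff.2 (hg0 x)).smul hg'
  · intro x
    exact norm_smul_inv_norm (𝕜 := ℝ) (hg0 x)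
  · intro x hx
    have : g x = x := (hge hx).trans (hid x (by linarith))
    simp only [this]

/-- The unit ball does not embed in a lower dimensional space. -/
lemma no_embed_ball {n m : ℕ} (hmn : m < n)
    (f : EuclideanSpace ℝ (Fin n) → EuclideanSpace ℝ (Fin m))
    (hcont : ContinuousOn f (Metric.closedBall 0 1))
    (hinj : Set.InjOn f (Metric.closedBall 0 1)) : False := by
  let B : Set (EuclideanSpace ℝ (Fin n)) := Metric.closedBall 0 1
  have hBc : IsCompact B := isCompact_closedBall _ _
  have : CompactSpace B := isCompact_iff_compactSpace.1 hBc
  let fB : C(B, EuclideanSpace ℝ (Fin m)) := ⟨B.domRestrict f, hcont.domRestrict⟩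
  have hemb : IsClosedEmbedding fB := fB.continuous.isClosedEmbedding hinj.injective
  obtain ⟨K, hK⟩ := (⟨Subtype.val, continuous_subtype_val⟩ :
    C(B, EuclideanSpace ℝ (Fin n))).exists_extension' hemb
  obtain ⟨f₁, hf₁⟩ := fB.exists_restrict_eq (s := B) hBc.isClosed
  have hKf : ∀ x ∈ B, K (f₁ x) = x := by
    intro x hx
    have a := congrFun hK ⟨x, hx⟩
    have b := DFunLike.congr_fun hf₁ ⟨x, hx⟩
    simp only [ContinuousMap.restrict_apply] at b
    rw [b]
    exact a
  obtain ⟨P, hP, hPa, -⟩ := K.continuous.exists_contDiff_approx 1 (ε := fun _ => 1 / 4)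
    continuous_const (fun _ => by norm_num)
  have hP' : ContDiff ℝ 1 P := hP
  have hdense := hP'.dense_compl_range_of_finrank_lt_finrank (by simpa using hmn)
  obtain ⟨c, hc, hcd⟩ := hdense.exists_dist_lt 0 (show (0 : ℝ) < 1 / 4 by norm_num)
  rw [dist_zero_left] at hcd
  let l : EuclideanSpace ℝ (Fin n) → ℝ := fun x => max 0 (min 1 (9 / 4 - 5 / 2 * ‖x‖))
  have hl : Continuous l := by fun_prop
  have hl0 : ∀ x, 0 ≤ l x := fun x => le_max_left _ _
  have hl1 : ∀ x, l x ≤ 1 := fun x => max_le (by norm_num) (min_le_left _ _)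
  have hlout : ∀ x, 9 / 10 ≤ ‖x‖ → l x = 0 := by
    intro x hx
    exact max_eq_left ((min_le_right _ _).trans (by linarith))
  have hlin : ∀ x, ‖x‖ ≤ 1 / 2 → l x = 1 := by
    intro x hx
    simp only [l]
    rw [min_eq_left (by linarith)]
    norm_num
  refine exists_zero_of_eq_id (fun x => x + l x • (P (f₁ x) - c - x)) ?_ ?_ ?_
  · have := hP'.continuous
    have := f₁.continuous
    fun_prop
  · intro x hx
    simp [hlout x hx]
  · intro x hx
    rcases le_or_gt ‖x‖ (1 / 2) with h | h
    · simp only [hlin x h, one_smul] at hx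
      refine hc ⟨f₁ x, ?_⟩
      have : P (f₁ x) - c = 0 := by rw [← hx]; abel
      exact sub_eq_zero.1 this
    · rcases le_or_gt ‖x‖ 1 with h' | h'
      · have hxB : x ∈ B := by simpa [B] using h'
        have h2 := hPa (f₁ x)
        rw [hKf x hxB, dist_eq_norm] at h2
        have h3 : ‖P (f₁ x) - c - x‖ ≤ 1 / 2 := by
          have e : P (f₁ x) - c - x = (P (f₁ x) - x) - c := by abel
          rw [e]
          exact (norm_sub_le _ _).trans (by linarith)
        have h4 : x = - (l x • (P (f₁ x) - c - x)) := eq_neg_of_add_eq_zero_left hx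
        have h5 : ‖x‖ = l x * ‖P (f₁ x) - c - x‖ := by
          conv_lhs => rw [h4]
          rw [norm_neg, norm_smul, Real.norm_of_nonneg (hl0 x)]
        have := hl0 x
        have := hl1 x
        nlinarith [norm_nonneg (P (f₁ x) - c - x)]
      · simp only [hlout x (by linarith), zero_smul, add_zero] at hx
        rw [hx, norm_zero] at h
        norm_num at h

theorem no_injective_continuous_into_lower_dim (n m : ℕ) (hmn : m < n)
    (U : Set (EuclideanSpace ℝ (Fin n))) (hU : IsOpen U) (hUne : U.Nonempty)
    (f : EuclideanSpace ℝ (Fin n) → EuclideanSpace ℝ (Fin m))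
    (hcont : ContinuousOn f U) (hinj : Set.InjOn f U) :
    False := by
  obtain ⟨p, hp⟩ := hUne
  obtain ⟨ε, hε, hball⟩ := Metric.nhds_basis_closedBall.mem_iff.1 (hU.mem_nhds hp)
  have hmaps : MapsTo (fun x : EuclideanSpace ℝ (Fin n) => p + ε • x)
      (Metric.closedBall 0 1) U := by
    intro x hx
    apply hball
    have hx' : ‖x‖ ≤ 1 := by simpa using hx
    simp only [Metric.mem_closedBall, dist_self_add_left, norm_smul, Real.norm_of_nonneg hε.le]
    nlinarith
  refine no_embed_ball hmn (fun x => f (p + ε • x)) ?_ ?_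
  · exact hcont.comp (by fun_prop) hmaps
  · intro x hx y hy hxy
    have := hinj (hmaps hx) (hmaps hy) hxy
    exact smul_right_injective _ hε.ne' (add_left_cancel this)
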